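/- arXiv:0708.2336 — 7 statements merged into one kernel-verified Lean document; each statement's English description precedes it below -/
import Mathlib

section
/- For every natural number k (including k = 0), there exists an unsatisfiable linear k-CNF formula. -/
/-- A clause: a finite set of literals, where a literal is a pair of a variable
and a sign (`true` = positive occurrence, `false` = negated occurrence). -/
abbrev Clause (V : Type) : Type := Finset (V × Bool)

/-- A CNF formula: a finite set of clauses. -/
abbrev CNF (V : Type) : Type := Finset (Finset (V × Bool))

/-- The set of variables occurring (possibly negated) in a clause. -/
def vbl {V : Type} [DecidableEq V] (C : Clause V) : Finset V := C.image Prod.fst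

/-- A clause is proper if it does not contain both a variable and its negation. -/
def ProperClause {V : Type} (C : Clause V) : Prop :=
  ∀ x : V, ¬ ((x, true) ∈ C ∧ (x, false) ∈ C)

/-- The literal `(x, b)` evaluates to true under `α` iff `α x = b`;
an assignment satisfies a clause if some literal evaluates to true. -/
def SatClause {V : Type} (α : V → Bool) (C : Clause V) : Prop :=
  ∃ l ∈ C, α l.1 = l.2

instance {V : Type} [DecidableEq V] (α : V → Bool) (C : Clause V) :
    Decidable (SatClause α C) := by unfold SatClause; infer_instance

/-- An assignment satisfies a formula if it satisfies every clause. -/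
def Satisfies {V : Type} (α : V → Bool) (F : CNF V) : Prop :=
  ∀ C ∈ F, SatClause α C

/-- A formula is unsatisfiable if no assignment satisfies it. -/
def Unsat {V : Type} (F : CNF V) : Prop := ∀ α : V → Bool, ¬ Satisfies α F

/-- A `k`-CNF: every clause is proper and has exactly `k` literals. -/
def IsKCNF {V : Type} (k : ℕ) (F : CNF V) : Prop :=
  ∀ C ∈ F, ProperClause C ∧ C.card = k

/-- A CNF is linear if any two distinct clauses share at most one variable. -/
def LinearCNF {V : Type} [DecidableEq V] (F : CNF V) : Prop :=
  ∀ C ∈ F, ∀ D ∈ F, C ≠ D → (vbl C ∩ vbl D).card ≤ 1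

theorem pow_mul_add_le_mul_succ_pow (t n : ℕ) : t ^ n * (t + n) ≤ t * (t + 1) ^ n := by
  induction n with
  | zero => simp
  | succ n ih =>
    calc t ^ (n + 1) * (t + (n + 1)) ≤ t ^ n * (t + n) * (t + 1) := by
          have h : t ^ n * (t * (t + (n + 1))) ≤ t ^ n * ((t + n) * (t + 1)) :=
            Nat.mul_le_mul_left _ (by nlinarith)
          calc _ = t ^ n * (t * (t + (n + 1))) := by ring
            _ ≤ _ := h
            _ = _ := by ring
      _ ≤ t * (t + 1) ^ n * (t + 1) := Nat.mul_le_mul_right _ ih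
      _ = t * (t + 1) ^ (n + 1) := by ring

theorem two_mul_pow_succ_le (t : ℕ) : 2 * t ^ (t + 1) ≤ (t + 1) ^ (t + 1) := by
  rcases Nat.eq_zero_or_pos t with rfl | ht
  · simp
  · have h := pow_mul_add_le_mul_succ_pow t (t + 1)
    refine Nat.le_of_mul_le_mul_left (le_trans ?_ h) ht
    nlinarith [Nat.zero_le (t ^ (t + 1))]

theorem two_pow_mul_pow_lt (t n m : ℕ) (h : (t + 1) * n < m) :
    2 ^ n * t ^ m < (t + 1) ^ m := by
  obtain ⟨r, rfl⟩ := Nat.exists_eq_add_of_lt h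
  have h1 : (2 * t ^ (t + 1)) ^ n ≤ ((t + 1) ^ (t + 1)) ^ n :=
    Nat.pow_le_pow_left (two_mul_pow_succ_le t) n
  have h2 : t ^ (r + 1) < (t + 1) ^ (r + 1) := Nat.pow_lt_pow_left (by omega) (by omega)
  calc 2 ^ n * t ^ ((t + 1) * n + r + 1) = (2 * t ^ (t + 1)) ^ n * t ^ (r + 1) := by
        rw [mul_pow, ← pow_mul]; ring
    _ < ((t + 1) ^ (t + 1)) ^ n * (t + 1) ^ (r + 1) :=
        Nat.mul_lt_mul_of_le_of_lt h1 h2 (by positivity)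
    _ = (t + 1) ^ ((t + 1) * n + r + 1) := by rw [← pow_mul]; ring

/-- A family of fewer than `(q / (q - 1)) ^ m` functions from an `m`-set to a `q`-set admits a
function agreeing somewhere with each member of the family. -/
theorem exists_forall_exists_eq {A E Q : Type*} [Fintype A] [Fintype E] [Fintype Q]
    (g : A → E → Q)
    (h : Fintype.card A * (Fintype.card Q - 1) ^ Fintype.card E <
      Fintype.card Q ^ Fintype.card E) :
    ∃ s : E → Q, ∀ a, ∃ e, s e = g a e := by
  classical
  by_contra! hs
  have hsub : (Finset.univ : Finset (E → Q)) ⊆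
      Finset.univ.biUnion fun a => Fintype.piFinset fun e => Finset.univ.erase (g a e) := by
    intro s _
    obtain ⟨a, ha⟩ := hs s
    simpa using ⟨a, ha⟩
  have hcard := (Finset.card_le_card hsub).trans Finset.card_biUnion_le
  simp [Fintype.card_piFinset, Finset.card_erase_of_mem] at hcard
  omega

/-- The variable at height `y` in column `i` of a grid. -/
def gridVar {p : ℕ} (i : ℕ) (y : ZMod p) : ℕ := Nat.pair i y.val

theorem gridVar_inj {p : ℕ} [NeZero p] {i j : ℕ} {y z : ZMod p} :
    gridVar i y = gridVar j z ↔ i = j ∧ y = z := by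
  simp [gridVar, Nat.pair_eq_pair, (ZMod.val_injective p).eq_iff]

/-- The clause on the variables of the line `y = e.1 * i + e.2`, with signs `s`. -/
def lineClause {p k : ℕ} (e : ZMod p × ZMod p) (s : Fin k → Bool) : Clause ℕ :=
  Finset.univ.image fun i : Fin k => (gridVar (i : ℕ) (e.1 * ((i : ℕ) : ZMod p) + e.2), s i)

theorem properClause_lineClause {p k : ℕ} [NeZero p] (e : ZMod p × ZMod p) (s : Fin k → Bool) :
    ProperClause (lineClause e s) := by
  rintro x ⟨h₁, h₂⟩
  simp only [lineClause, Finset.mem_image, Finset.mem_univ, true_and, Prod.mk.injEq] at h₁ h₂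
  obtain ⟨i, hi, hsi⟩ := h₁
  obtain ⟨j, hj, hsj⟩ := h₂
  have hij : i = j := Fin.ext (gridVar_inj.1 (hi.trans hj.symm)).1
  simp [← hij, hsi] at hsj

theorem card_lineClause {p k : ℕ} [NeZero p] (e : ZMod p × ZMod p) (s : Fin k → Bool) :
    (lineClause e s).card = k := by
  rw [lineClause, Finset.card_image_of_injective, Finset.card_univ, Fintype.card_fin]
  intro i j hij
  exact Fin.ext (gridVar_inj.1 (Prod.ext_iff.1 hij).1).1

theorem mem_vbl_lineClause {p k : ℕ} {e : ZMod p × ZMod p} {s : Fin k → Bool} {x : ℕ} :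
    x ∈ vbl (lineClause e s) ↔ ∃ i : Fin k, gridVar (i : ℕ) (e.1 * ((i : ℕ) : ZMod p) + e.2) = x := by
  simp [vbl, lineClause]

theorem card_vbl_inter_lineClause_le_one {p k : ℕ} [Fact p.Prime] (hkp : k ≤ p)
    {e f : ZMod p × ZMod p} (hef : e ≠ f) (s t : Fin k → Bool) :
    (vbl (lineClause e s) ∩ vbl (lineClause f t)).card ≤ 1 := by
  rw [Finset.card_le_one]
  intro x hx y hy
  simp only [Finset.mem_inter, mem_vbl_lineClause] at hx hy
  obtain ⟨⟨i, rfl⟩, i', hi⟩ := hx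
  obtain ⟨⟨j, rfl⟩, j', hj⟩ := hy
  obtain ⟨hi₁, hi₂⟩ := gridVar_inj.1 hi
  obtain ⟨hj₁, hj₂⟩ := gridVar_inj.1 hj
  rw [hi₁] at hi₂
  rw [hj₁] at hj₂
  have hmul : (f.1 - e.1) * (((i : ℕ) : ZMod p) - ((j : ℕ) : ZMod p)) = 0 := by
    linear_combination hi₂ - hj₂
  rcases mul_eq_zero.1 hmul with h | h
  · have h₁ : f.1 = e.1 := sub_eq_zero.1 h
    rw [h₁] at hi₂
    exact absurd (Prod.ext h₁.symm (add_left_cancel hi₂).symm) hef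
  · have hij : (i : ℕ) = j := by
      have := (ZMod.natCast_eq_natCast_iff' _ _ _).1 (sub_eq_zero.1 h)
      rwa [Nat.mod_eq_of_lt (by omega), Nat.mod_eq_of_lt (by omega)] at this
    rw [hij]

/-- For every natural number `k` (including `k = 0`), there exists an
unsatisfiable linear `k`-CNF formula. -/
theorem unsatisfiable_linear_kCNF_exists (k : ℕ) :
    ∃ F : CNF ℕ, IsKCNF k F ∧ LinearCNF F ∧ Unsat F := by
  obtain ⟨p, hp, hprime⟩ := Nat.exists_infinite_primes (k * 2 ^ k + 1)
  have : Fact p.Prime := ⟨hprime⟩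
  have hkp : k ≤ p := by
    have : k * 1 ≤ k * 2 ^ k := Nat.mul_le_mul_left k Nat.one_le_two_pow
    omega
  obtain ⟨s, hs⟩ := exists_forall_exists_eq
    (fun (β : Fin k × ZMod p → Bool) (e : ZMod p × ZMod p) (i : Fin k) =>
      !β (i, e.1 * ((i : ℕ) : ZMod p) + e.2)) (by
    obtain ⟨t, ht⟩ := Nat.exists_eq_add_of_le' (Nat.one_le_two_pow (n := k))
    have hm : (t + 1) * (k * p) < p * p := by
      rw [← ht, ← mul_assoc, mul_comm (2 ^ k) k]
      exact Nat.mul_lt_mul_of_pos_right (by omega) hprime.pos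
    simpa [ZMod.card, ht] using two_pow_mul_pow_lt t (k * p) (p * p) hm)
  refine ⟨Finset.univ.image fun e => lineClause e (s e), ?_, ?_, ?_⟩
  · intro C hC
    obtain ⟨e, -, rfl⟩ := Finset.mem_image.1 hC
    exact ⟨properClause_lineClause e _, card_lineClause e _⟩
  · intro C hC D hD hne
    obtain ⟨e, -, rfl⟩ := Finset.mem_image.1 hC
    obtain ⟨f, -, rfl⟩ := Finset.mem_image.1 hD
    exact card_vbl_inter_lineClause_le_one hkp (fun h => hne (by rw [h])) _ _
  · intro α hα
    obtain ⟨e, he⟩ := hs fun v => α (gridVar (v.1 : ℕ) v.2)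
    obtain ⟨l, hl, hαl⟩ := hα _ (Finset.mem_image_of_mem _ (Finset.mem_univ e))
    obtain ⟨i, -, rfl⟩ := Finset.mem_image.1 (show l ∈ Finset.image _ _ from hl)
    simp [he] at hαl
end

section
/- If there exists an unsatisfiable linear k-CNF formula with m clauses, then there exists an unsatisfiable linear (k+1)-CNF formula with m·2^m clauses. Concretely, given an unsatisfiable linear k-CNF F = {C₁,…,C_m}, take 2^m variable-disjoint copies F₁,…,F_{2^m} of F, introduce m fresh variables x₁,…,x_m, enumerate the 2^m clauses D₁,…,D_{2^m} over x₁,…,x_m (each D_j contains exactly one literal u_i ∈ {x_i, x̄_i} for each i), and form F' = ⋃_{j=1}^{2^m} { C_i^{(j)} ∪ {u_i^{(j)}} : i = 1,…,m } where C_i^{(j)} is the i-th clause of F_j and u_i^{(j)} is the i-th literal of D_j; then F' is an unsatisfiable linear (k+1)-CNF. -/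
namespace CNFStep

variable {V I J W : Type} [DecidableEq W]

/-- The image of `C` in the copy `j` of the variable set, extended by the literal `(i, b)` on the
fresh variable `i`; all variables are renamed along `e`. -/
def extend (e : (J × V) ⊕ I → W) (j : J) (i : I) (b : Bool) (C : Clause V) : Clause W :=
  insert (e (.inr i), b) (C.image fun l => (e (.inl (j, l.1)), l.2))

theorem mem_extend {e : (J × V) ⊕ I → W} {j : J} {i : I} {b : Bool} {C : Clause V}
    {v : W} {s : Bool} : (v, s) ∈ extend e j i b C ↔
      (v = e (.inr i) ∧ s = b) ∨ ∃ x, (x, s) ∈ C ∧ e (.inl (j, x)) = v := by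
  simp [extend]

theorem mem_extend_inr {e : (J × V) ⊕ I → W} (he : e.Injective) {j : J} {i i' : I} {b s : Bool}
    {C : Clause V} : (e (.inr i'), s) ∈ extend e j i b C ↔ i' = i ∧ s = b := by
  simp [mem_extend, he.eq_iff]

theorem mem_extend_inl {e : (J × V) ⊕ I → W} (he : e.Injective) {j j' : J} {i : I} {b s : Bool}
    {C : Clause V} {x : V} :
    (e (.inl (j', x)), s) ∈ extend e j i b C ↔ j' = j ∧ (x, s) ∈ C := by
  simp [mem_extend, he.eq_iff]
  grind

theorem properClause_extend {e : (J × V) ⊕ I → W} (he : e.Injective) {j : J} {i : I} {b : Bool}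
    {C : Clause V} (hC : ProperClause C) : ProperClause (extend e j i b C) := by
  rintro v ⟨h₁, h₂⟩
  rcases mem_extend.1 h₁ with ⟨rfl, hb⟩ | ⟨x, hx, rfl⟩
  · have := ((mem_extend_inr he).1 h₂).2
    simp_all
  · exact hC x ⟨hx, ((mem_extend_inl he).1 h₂).2⟩

theorem card_extend {e : (J × V) ⊕ I → W} (he : e.Injective) (j : J) (i : I) (b : Bool)
    (C : Clause V) : (extend e j i b C).card = C.card + 1 := by
  rw [extend, Finset.card_insert_of_notMem, Finset.card_image_of_injective]
  · rintro ⟨x, s⟩ ⟨y, t⟩ h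
    simpa [he.eq_iff] using h
  · simp [he.eq_iff]

theorem vbl_extend [DecidableEq V] (e : (J × V) ⊕ I → W) (j : J) (i : I) (b : Bool)
    (C : Clause V) :
    vbl (extend e j i b C) = insert (e (.inr i)) ((vbl C).image fun x => e (.inl (j, x))) := by
  simp [vbl, extend, Finset.image_image, Function.comp_def]

theorem card_vbl_inter_le_of_ne_copy [DecidableEq V] {e : (J × V) ⊕ I → W} (he : e.Injective)
    {j j' : J} (hj : j ≠ j') (i i' : I) (b b' : Bool) (C C' : Clause V) :
    (vbl (extend e j i b C) ∩ vbl (extend e j' i' b' C')).card ≤ 1 := by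
  refine (Finset.card_le_card (t := {e (.inr i)}) fun v hv => ?_).trans (by simp)
  simp only [vbl_extend, Finset.mem_inter, Finset.mem_insert, Finset.mem_image] at hv
  obtain ⟨rfl | ⟨x, -, rfl⟩, h⟩ := hv
  · simp
  · simp [he.eq_iff, hj.symm] at h

theorem card_vbl_inter_le_of_ne_fresh [DecidableEq V] {e : (J × V) ⊕ I → W} (he : e.Injective)
    (j : J) {i i' : I} (hi : i ≠ i') (b b' : Bool) (C C' : Clause V) :
    (vbl (extend e j i b C) ∩ vbl (extend e j i' b' C')).card ≤ (vbl C ∩ vbl C').card := by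
  refine (Finset.card_le_card (t := (vbl C ∩ vbl C').image fun x => e (.inl (j, x)))
    fun v hv => ?_).trans Finset.card_image_le
  simp only [vbl_extend, Finset.mem_inter, Finset.mem_insert, Finset.mem_image] at hv ⊢
  obtain ⟨rfl | ⟨x, hx, rfl⟩, h⟩ := hv
  · simp [he.eq_iff, hi] at h
  · simp only [he.eq_iff, reduceCtorEq, false_or, Sum.inl.injEq, Prod.mk.injEq, true_and,
      exists_eq_right] at h
    exact ⟨x, ⟨hx, h⟩, rfl⟩

theorem satClause_of_satClause_extend {e : (J × V) ⊕ I → W} {j : J} {i : I} {b : Bool}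
    {C : Clause V} {α : W → Bool} (hb : α (e (.inr i)) ≠ b) (h : SatClause α (extend e j i b C)) :
    SatClause (fun x => α (e (.inl (j, x)))) C := by
  obtain ⟨⟨v, s⟩, hl, hs⟩ := h
  rcases mem_extend.1 hl with ⟨rfl, rfl⟩ | ⟨x, hx, rfl⟩
  · exact absurd hs hb
  · exact ⟨(x, s), hx, hs⟩

variable {F : CNF V}

/-- One extended copy of every clause of `F` for each sign pattern on the fresh variables, which
are indexed by the clauses of `F`. -/
def step (e : ((F → Bool) × V) ⊕ F → W) (p : (F → Bool) × F) : Clause W :=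
  extend e p.1 p.2 (p.1 p.2) p.2.1

theorem step_injective {k : ℕ} (hF : IsKCNF k F) {e : ((F → Bool) × V) ⊕ F → W}
    (he : e.Injective) : (step e).Injective := by
  rintro ⟨j, i⟩ ⟨j', i'⟩ h
  have h_fresh : (e (.inr i), j i) ∈ step e (j', i') := h ▸ (mem_extend_inr he).2 ⟨rfl, rfl⟩
  obtain ⟨rfl, hji⟩ := (mem_extend_inr he).1 h_fresh
  suffices j = j' by rw [this]
  obtain hC | ⟨⟨x, s⟩, hx⟩ := i.1.eq_empty_or_nonempty
  · have hk : k = 0 := by rw [← (hF _ i.2).2, hC, Finset.card_empty]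
    funext D
    have hD : D = i :=
      Subtype.ext ((Finset.card_eq_zero.1 ((hF _ D.2).2.trans hk)).trans hC.symm)
    rw [hD, hji]
  · have h_old : (e (.inl (j, x)), s) ∈ step e (j', i) :=
      h ▸ (mem_extend_inl he).2 ⟨rfl, hx⟩
    exact ((mem_extend_inl he).1 h_old).1

end CNFStep

/-- If there exists an unsatisfiable linear `k`-CNF formula with `m`
clauses, then there exists an unsatisfiable linear `(k+1)`-CNF formula with `m·2^m`
clauses. -/
theorem unsat_linear_step (k m : ℕ)
    (h : ∃ F : CNF ℕ, IsKCNF k F ∧ LinearCNF F ∧ Unsat F ∧ F.card = m) :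
    ∃ F' : CNF ℕ, IsKCNF (k + 1) F' ∧ LinearCNF F' ∧ Unsat F' ∧ F'.card = m * 2 ^ m := by
  classical
  obtain ⟨F, hF, hlin, hunsat, rfl⟩ := h
  obtain ⟨e, he⟩ := exists_injective_nat (((F → Bool) × ℕ) ⊕ F)
  refine ⟨Finset.univ.image (CNFStep.step e), ?_, ?_, ?_, ?_⟩
  · simp only [IsKCNF, Finset.mem_image, Finset.mem_univ, true_and, forall_exists_index,
      forall_apply_eq_imp_iff]
    rintro ⟨j, i⟩
    exact ⟨CNFStep.properClause_extend he (hF _ i.2).1,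
      (CNFStep.card_extend he _ _ _ _).trans (by rw [(hF _ i.2).2])⟩
  · simp only [LinearCNF, Finset.mem_image, Finset.mem_univ, true_and, forall_exists_index,
      forall_apply_eq_imp_iff]
    rintro ⟨j, i⟩ ⟨j', i'⟩ hne
    by_cases hj : j = j'
    · subst hj
      have hi : i ≠ i' := by
        rintro rfl
        exact hne rfl
      exact (CNFStep.card_vbl_inter_le_of_ne_fresh he j hi _ _ _ _).trans
        (hlin _ i.2 _ i'.2 (Subtype.coe_injective.ne hi))
    · exact CNFStep.card_vbl_inter_le_of_ne_copy he hj _ _ _ _ _ _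
  · intro α hα
    let j : F → Bool := fun i => !α (e (.inr i))
    refine hunsat (fun x => α (e (.inl (j, x)))) fun C hC => ?_
    exact CNFStep.satClause_of_satClause_extend (i := ⟨C, hC⟩) (b := j ⟨C, hC⟩) (by simp [j])
      (hα _ (Finset.mem_image_of_mem _ (Finset.mem_univ ((j, ⟨C, hC⟩) : (F → Bool) × F))))
  · rw [Finset.card_image_of_injective _ (CNFStep.step_injective hF he)]
    simp [mul_comm]
end

section
/- Fix k ≥ 1 and let P be a structural property of k-CNF formulas, i.e., a property that depends only on the skeleton {vbl(C) : C ∈ F}. Let ex_P(n,k) be the maximum number of clauses of a k-CNF over n variables having property P. If ex_P(n,k) grows superlinearly in n (i.e., ex_P(n,k)/n → ∞ as n → ∞), then for every ε > 0 there exists a k-CNF formula F_ε having property P such that no assignment satisfies more than (1 - 2^{-k} + ε)·|F_ε| clauses of F_ε. -/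
open Finset in
/-- Derandomized averaging: if every weight `w B A ·` has mean at most `c` on `t A`, then choosing
the values one index at a time keeps the total product weight at most `#U * c ^ #S`. -/
theorem exists_choice_sum_prod_le {ι β γ : Type*} [DecidableEq ι] (S : Finset ι) (U : Finset β)
    (t : ι → Finset γ) (w : β → ι → γ → ℝ) (c : ℝ) (hw : ∀ B A T, 0 ≤ w B A T)
    (ht : ∀ A ∈ S, (t A).Nonempty)
    (hmean : ∀ A ∈ S, ∀ B ∈ U, ∑ T ∈ t A, w B A T ≤ c * #(t A)) :
    ∃ T : ∀ A ∈ S, γ, (∀ A hA, T A hA ∈ t A) ∧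
      ∑ B ∈ U, ∏ A ∈ S.attach, w B A (T A A.2) ≤ #U * c ^ #S := by
  suffices h : ∑ T ∈ S.pi t, ∑ B ∈ U, ∏ A ∈ S.attach, w B A (T A A.2) ≤
      ∑ T ∈ S.pi t, #U * c ^ #S by
    obtain ⟨T, hT, hle⟩ := exists_le_of_sum_le (pi_nonempty.2 ht) h
    exact ⟨T, fun A hA => mem_pi.1 hT A hA, hle⟩
  rw [sum_comm]
  calc ∑ B ∈ U, ∑ T ∈ S.pi t, ∏ A ∈ S.attach, w B A (T A A.2)
      = ∑ B ∈ U, ∏ A ∈ S, ∑ T ∈ t A, w B A T := by simp_rw [prod_sum]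
    _ ≤ ∑ B ∈ U, ∏ A ∈ S, (c * #(t A)) :=
        sum_le_sum fun B hB => prod_le_prod (fun A _ => sum_nonneg fun T _ => hw B A T)
          fun A hA => hmean A hA B hB
    _ = _ := by
        simp only [sum_const, nsmul_eq_mul, prod_mul_distrib, prod_const, card_pi]
        push_cast
        ring

/-- The Chernoff-type estimate behind the union bound over all `2 ^ n` assignments. -/
theorem two_pow_mul_pow_le_exp {p ε : ℝ} (hp0 : 0 ≤ p) (hp1 : p ≤ 1) (hε0 : 0 < ε) (hε1 : ε ≤ 1)
    {n m : ℕ} (h : 4 * (n : ℝ) ≤ ε ^ 2 * m) :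
    2 ^ n * (1 - p * (1 - Real.exp (-(ε / 2)))) ^ m ≤ Real.exp (-(ε / 2) * ((p - ε) * m)) := by
  have hexp : Real.exp (-(ε / 2)) ≤ 1 - ε / 2 + (ε / 2) ^ 2 := by
    have := (abs_le.1 (Real.abs_exp_sub_one_sub_id_le (x := -(ε / 2))
      (by rw [abs_neg, abs_of_pos] <;> linarith))).2
    nlinarith
  have hle1 : Real.exp (-(ε / 2)) ≤ 1 := Real.exp_le_one_iff.2 (by linarith)
  have hpos := Real.exp_pos (-(ε / 2))
  have hbase : 1 - p * (1 - Real.exp (-(ε / 2))) ≤ Real.exp (-(p * (ε / 2)) + (ε / 2) ^ 2) := by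
    refine le_trans ?_ (Real.add_one_le_exp _)
    nlinarith [mul_le_mul_of_nonneg_left hexp hp0,
      mul_le_mul_of_nonneg_right hp1 (sq_nonneg (ε / 2))]
  have htwo : (2 : ℝ) ≤ Real.exp 1 := by linarith [Real.add_one_le_exp (1 : ℝ)]
  have hbase0 : 0 ≤ 1 - p * (1 - Real.exp (-(ε / 2))) := by nlinarith
  calc 2 ^ n * (1 - p * (1 - Real.exp (-(ε / 2)))) ^ m
      ≤ Real.exp 1 ^ n * Real.exp (-(p * (ε / 2)) + (ε / 2) ^ 2) ^ m := by gcongr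
    _ = Real.exp (n * 1 + m * (-(p * (ε / 2)) + (ε / 2) ^ 2)) := by
        rw [Real.exp_add (n * 1), Real.exp_nat_mul, Real.exp_nat_mul]
    _ ≤ _ := Real.exp_le_exp.2 (by nlinarith)

open Finset in
/-- A large family of `k`-sets on `n` points admits a choice of a subset `T A` of each member `A`
such that every `B` has trace `T A` on almost the expected proportion `2⁻ᵏ` of the members. -/
theorem exists_subsets_card_trace_ge (k n : ℕ) (S : Finset (Finset ℕ))
    (hS : ∀ A ∈ S, #A = k) {ε : ℝ} (hε0 : 0 < ε) (hε1 : ε ≤ 1)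
    (h : 4 * (n : ℝ) ≤ ε ^ 2 * #S) :
    ∃ T : Finset ℕ → Finset ℕ, (∀ A ∈ S, T A ⊆ A) ∧
      ∀ B ⊆ range n, (((2 : ℝ) ^ k)⁻¹ - ε) * #S ≤ #{A ∈ S | A ∩ B = T A} := by
  set p : ℝ := ((2 : ℝ) ^ k)⁻¹ with hp
  have hp0 : 0 < p := by positivity
  have hp1 : p ≤ 1 := inv_le_one_of_one_le₀ (one_le_pow₀ one_le_two)
  set e := Real.exp (-(ε / 2)) with he
  have he0 : 0 < e := Real.exp_pos _
  have he1 : e ≤ 1 := Real.exp_le_one_iff.2 (by linarith)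
  obtain ⟨T, hT, hsum⟩ := exists_choice_sum_prod_le S (range n).powerset powerset
    (fun B A T => if A ∩ B = T then e else 1) (1 - p * (1 - e))
    (fun B A T => by split_ifs <;> linarith) (fun A _ => ⟨∅, by simp⟩) (by
      intro A hA B _
      have hsplit : ∀ T, (if A ∩ B = T then e else 1) = 1 - if A ∩ B = T then 1 - e else 0 := by
        intro T; split_ifs <;> ring
      simp only [hsplit, sum_sub_distrib, sum_ite_eq, mem_powerset, inter_subset_left, if_true,
        sum_const, card_powerset, hS A hA, nsmul_eq_mul, hp]
      push_cast
      field_simp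
      exact le_rfl)
  have hbound := hsum.trans (by
    simpa using two_pow_mul_pow_le_exp hp0.le hp1 hε0 hε1 h)
  refine ⟨fun A => if hA : A ∈ S then T A hA else ∅, fun A hA => ?_, fun B hB => ?_⟩
  · simpa [hA] using hT A hA
  have hterm := (single_le_sum (f := fun B => ∏ A ∈ S.attach, if (A : Finset ℕ) ∩ B = T A A.2 then
    e else 1) (fun B _ => prod_nonneg fun A _ => by split_ifs <;> linarith)
    (mem_powerset.2 hB)).trans hbound
  have hprod : (∏ A ∈ S.attach, if (A : Finset ℕ) ∩ B = T A A.2 then e else 1) =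
      e ^ #{A ∈ S | A ∩ B = if hA : A ∈ S then T A hA else ∅} := by
    rw [← prod_const, prod_filter, ← prod_attach S]
    exact prod_congr rfl fun A _ => by simp
  rw [hprod, he, ← Real.exp_nat_mul, Real.exp_le_exp] at hterm
  beta_reduce
  nlinarith

/-- The clause on the variable set `A` whose positive variables are those in `T`. -/
def clauseOf {V : Type} [DecidableEq V] (A T : Finset V) : Clause V :=
  A.image fun x => (x, decide (x ∈ T))

section ClauseOf

variable {V : Type} [DecidableEq V]

theorem vbl_clauseOf (A T : Finset V) : vbl (clauseOf A T) = A := by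
  simp [vbl, clauseOf, Finset.image_image, Function.comp_def]

theorem card_clauseOf (A T : Finset V) : (clauseOf A T).card = A.card :=
  Finset.card_image_of_injective _ fun _ _ h => (Prod.ext_iff.1 h).1

theorem properClause_clauseOf (A T : Finset V) : ProperClause (clauseOf A T) := by
  intro x
  simp +contextual [clauseOf]

theorem not_satClause_clauseOf {A B T : Finset V} {α : V → Bool}
    (hB : ∀ x ∈ A, x ∈ B ↔ α x = false) (h : A ∩ B = T) : ¬ SatClause α (clauseOf A T) := by
  subst h
  rintro ⟨l, hl, hα⟩
  obtain ⟨x, hx, rfl⟩ := Finset.mem_image.1 hl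
  simp only [Finset.mem_inter, hx, hB x hx, true_and] at hα
  cases hαx : α x <;> simp [hαx] at hα

theorem ProperClause.card_vbl {C : Clause V} (hC : ProperClause C) : (vbl C).card = C.card := by
  refine Finset.card_image_of_injOn ?_
  rintro ⟨x, b⟩ hb ⟨y, c⟩ hc (rfl : x = y)
  rw [Finset.mem_coe] at hb hc
  have := hC x
  cases b <;> cases c <;> first | rfl | exact absurd ⟨‹_›, ‹_›⟩ this

/-- A family of `k`-clauses has at most `4 ^ k` times as many members as its skeleton. -/
theorem IsKCNF.card_le {k : ℕ} {F : CNF V} (hF : IsKCNF k F) :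
    F.card ≤ 4 ^ k * (F.image vbl).card := by
  refine Finset.card_le_mul_card_image F _ fun A hA => ?_
  obtain ⟨C, hC, rfl⟩ := Finset.mem_image.1 hA
  calc _ ≤ ((vbl C) ×ˢ (Finset.univ : Finset Bool)).powerset.card := by
        refine Finset.card_le_card fun D hD => Finset.mem_powerset.2 fun l hl => ?_
        rw [← (Finset.mem_filter.1 hD).2]
        exact Finset.mem_product.2 ⟨Finset.mem_image_of_mem Prod.fst hl, Finset.mem_univ _⟩
    _ = 4 ^ k := by
        rw [Finset.card_powerset, Finset.card_product, (hF C hC).1.card_vbl, (hF C hC).2,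
          Finset.card_univ, Fintype.card_bool, mul_comm, pow_mul]
        norm_num

end ClauseOf

open Finset in
/-- A `k`-uniform skeleton with sufficiently many members on `n` points carries a `k`-CNF of which
no assignment satisfies noticeably more than the expected proportion `1 - 2⁻ᵏ`. -/
theorem exists_isKCNF_image_vbl_eq (k n : ℕ) (S : Finset (Finset ℕ))
    (hS : ∀ A ∈ S, #A = k) (hSn : ∀ A ∈ S, A ⊆ range n) {ε : ℝ} (hε0 : 0 < ε) (hε1 : ε ≤ 1)
    (h : 4 * (n : ℝ) ≤ ε ^ 2 * #S) :
    ∃ F : CNF ℕ, IsKCNF k F ∧ F.image vbl = S ∧ ∀ α : ℕ → Bool,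
      (#{C ∈ F | SatClause α C} : ℝ) ≤ (1 - ((2 : ℝ) ^ k)⁻¹ + ε) * #F := by
  obtain ⟨T, -, hT⟩ := exists_subsets_card_trace_ge k n S hS hε0 hε1 h
  have hinj : Function.Injective fun A => clauseOf A (T A) :=
    Function.LeftInverse.injective (g := vbl) fun A => vbl_clauseOf A (T A)
  refine ⟨S.image fun A => clauseOf A (T A), ?_, ?_, fun α => ?_⟩
  · intro C hC
    obtain ⟨A, hA, rfl⟩ := mem_image.1 hC
    exact ⟨properClause_clauseOf _ _, by rw [card_clauseOf, hS A hA]⟩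
  · simp [image_image, Function.comp_def, vbl_clauseOf]
  have hB := hT {x ∈ range n | α x = false} (filter_subset _ _)
  have hle : #{A ∈ S | A ∩ {x ∈ range n | α x = false} = T A} ≤
      #{A ∈ S | ¬ SatClause α (clauseOf A (T A))} := by
    refine card_le_card fun A hA => ?_
    obtain ⟨hA, hAT⟩ := mem_filter.1 hA
    exact mem_filter.2 ⟨hA, not_satClause_clauseOf
      (fun x hx => by simpa using fun _ => mem_range.1 (hSn A hA hx)) hAT⟩
  have hsplit := card_filter_add_card_filter_not (s := S)
    fun A => SatClause α (clauseOf A (T A))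
  rw [filter_image, card_image_of_injective _ hinj, card_image_of_injective _ hinj]
  have hle' : (#{A ∈ S | A ∩ {x ∈ range n | α x = false} = T A} : ℝ) ≤
      #{A ∈ S | ¬ SatClause α (clauseOf A (T A))} := by exact_mod_cast hle
  have hsplit' : (#{A ∈ S | SatClause α (clauseOf A (T A))} : ℝ) +
      #{A ∈ S | ¬ SatClause α (clauseOf A (T A))} = #S := by exact_mod_cast hsplit
  linarith

/-- Fix `k ≥ 1` and let `P` be a structural property of CNF
formulas, i.e. one depending only on the skeleton `{vbl C : C ∈ F}`. Let
`exP n` be the maximum number of clauses of a `k`-CNF over `n` variables having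
property `P`. If `exP n` grows superlinearly in `n`, then for every `ε > 0` there is a
`k`-CNF formula `F` with property `P` such that no assignment satisfies more than
`(1 - 2^{-k} + ε)·|F|` of its clauses. -/
theorem structural_property_partial_sat (k : ℕ) (hk : 1 ≤ k)
    (P : CNF ℕ → Prop)
    (hstruct : ∀ F G : CNF ℕ, F.image vbl = G.image vbl → (P F ↔ P G))
    (exP : ℕ → ℕ)
    (hex : ∀ n : ℕ, IsGreatest
      {m : ℕ | ∃ F : CNF ℕ, IsKCNF k F ∧ (∀ C ∈ F, vbl C ⊆ Finset.range n) ∧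
        P F ∧ F.card = m} (exP n))
    (hsuper : Filter.Tendsto (fun n : ℕ => (exP n : ℝ) / n) Filter.atTop Filter.atTop) :
    ∀ ε : ℝ, 0 < ε → ∃ F : CNF ℕ, IsKCNF k F ∧ P F ∧
      ∀ α : ℕ → Bool,
        ((F.filter fun C => SatClause α C).card : ℝ) ≤
          (1 - (2 : ℝ) ^ (-(k : ℤ)) + ε) * F.card := by
  intro ε hε
  obtain ⟨n, hn1, hn⟩ := (Filter.eventually_ge_atTop 1 |>.and
    (hsuper.eventually_ge_atTop (4 ^ k * (4 / min ε 1 ^ 2)))).exists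
  obtain ⟨F, hF, hFn, hPF, hcard⟩ := (hex n).1
  have hmin : 0 < min ε 1 := lt_min hε one_pos
  have hn0 : (0 : ℝ) < n := by exact_mod_cast hn1
  have hFS : (exP n : ℝ) ≤ 4 ^ k * (F.image vbl).card := by
    rw [← hcard]
    exact_mod_cast hF.card_le
  have hlarge : 4 * (n : ℝ) ≤ min ε 1 ^ 2 * (F.image vbl).card := by
    have h1 := ((le_div_iff₀ hn0).1 hn).trans hFS
    rw [mul_assoc] at h1
    have h2 := le_of_mul_le_mul_left h1 (by positivity)
    rwa [div_mul_eq_mul_div, div_le_iff₀' (by positivity)] at h2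
  obtain ⟨G, hG, hGF, hsat⟩ := exists_isKCNF_image_vbl_eq k n (F.image vbl)
    (fun A hA => by
      obtain ⟨C, hC, rfl⟩ := Finset.mem_image.1 hA
      rw [(hF C hC).1.card_vbl, (hF C hC).2])
    (fun A hA => by
      obtain ⟨C, hC, rfl⟩ := Finset.mem_image.1 hA
      exact hFn C hC) hmin (min_le_right _ _) hlarge
  refine ⟨G, hG, (hstruct G F hGF).2 hPF, fun α => (hsat α).trans ?_⟩
  rw [zpow_neg, zpow_natCast]
  gcongr
  exact min_le_left _ _
end

section
/- Let F be a CNF formula in which every clause has size at least 2. If for every clause C ∈ F it holds that Σ_{D ∈ Γ(C)} 2^{-|D|} ≤ 1/4, then F is satisfiable. -/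
/-- The neighborhood `Γ(C)` of a clause `C` in `F`: the clauses of `F` other than `C`
sharing at least one variable with `C`. -/
def Gamma {V : Type} [DecidableEq V] (F : CNF V) (C : Clause V) : Finset (Clause V) :=
  F.filter fun D => D ≠ C ∧ (vbl D ∩ vbl C).Nonempty

open scoped Classical in
/-- Fixing the value of a variable on which a property does not depend halves the number of
assignments, in any set of assignments closed under flipping that variable. -/
theorem card_filter_eq_and_mul_two {V : Type} [DecidableEq V] (Ω : Finset (V → Bool)) (x : V)
    (hΩ : ∀ α ∈ Ω, Function.update α x (!α x) ∈ Ω) (Q : (V → Bool) → Prop)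
    (hQ : ∀ α b, Q (Function.update α x b) ↔ Q α) (b : Bool) :
    (Ω.filter fun α => α x = b ∧ Q α).card * 2 = (Ω.filter Q).card := by
  have hflip : (Ω.filter fun α => α x = b ∧ Q α).card
      = (Ω.filter fun α => α x ≠ b ∧ Q α).card := by
    refine Finset.card_bij' (fun α _ => Function.update α x (!α x))
      (fun α _ => Function.update α x (!α x)) ?_ ?_ ?_ ?_
    · intro α hα
      simp only [Finset.mem_filter] at hα ⊢
      refine ⟨hΩ α hα.1, ?_, (hQ _ _).2 hα.2.2⟩
      simp [hα.2.1]
    · intro α hα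
      simp only [Finset.mem_filter] at hα ⊢
      refine ⟨hΩ α hα.1, ?_, (hQ _ _).2 hα.2.2⟩
      simpa using Bool.eq_not.2 hα.2.1
    · intro α _
      simp
    · intro α _
      simp
  have hsplit := Finset.card_filter_add_card_filter_not (s := Ω.filter Q) (fun α => α x = b)
  simp only [Finset.filter_filter] at hsplit
  simp only [and_comm (a := Q _)] at hsplit
  simp only [ne_eq] at hflip
  omega

open scoped Classical in
/-- A property not depending on the variables of a proper clause `C` is independent of the
event that `C` is violated, which has probability `2 ^ (-|C|)`. -/
theorem card_filter_not_satClause_mul_two_pow {V : Type} [DecidableEq V]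
    (Ω : Finset (V → Bool)) (C : Clause V) (hC : ProperClause C)
    (hΩ : ∀ x ∈ vbl C, ∀ α ∈ Ω, Function.update α x (!α x) ∈ Ω) (Q : (V → Bool) → Prop)
    (hQ : ∀ x ∈ vbl C, ∀ α b, Q (Function.update α x b) ↔ Q α) :
    (Ω.filter fun α => ¬ SatClause α C ∧ Q α).card * 2 ^ C.card = (Ω.filter Q).card := by
  induction C using Finset.induction_on with
  | empty => simp [SatClause]
  | insert l C hl ih =>
    have hsub : vbl C ⊆ vbl (insert l C) := Finset.image_subset_image (Finset.subset_insert l C)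
    have hmem : l.1 ∈ vbl (insert l C) := Finset.mem_image_of_mem _ (Finset.mem_insert_self l C)
    have hfresh : ∀ m ∈ C, m.1 ≠ l.1 := by
      rintro ⟨x, s⟩ hm rfl
      obtain ⟨y, t⟩ := l
      have h := hC y
      simp only [Finset.mem_insert] at h
      cases s <;> cases t <;> simp_all
    have ih' := ih (fun x h => hC x ⟨Finset.mem_insert_of_mem h.1, Finset.mem_insert_of_mem h.2⟩)
      (fun x hx => hΩ x (hsub hx)) (fun x hx => hQ x (hsub hx))
    have hhalf := card_filter_eq_and_mul_two Ω l.1 (hΩ l.1 hmem)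
      (fun α => ¬ SatClause α C ∧ Q α) (fun α b => by
        have hiff : SatClause (Function.update α l.1 b) C ↔ SatClause α C := by
          unfold SatClause
          refine exists_congr fun m => and_congr_right fun hm => ?_
          rw [Function.update_of_ne (hfresh m hm)]
        rw [hiff, hQ l.1 hmem]) (!l.2)
    have heq : (Ω.filter fun α => ¬ SatClause α (insert l C) ∧ Q α)
        = Ω.filter fun α => α l.1 = (!l.2) ∧ ¬ SatClause α C ∧ Q α := by
      refine Finset.filter_congr fun α _ => ?_
      simp only [SatClause, Finset.exists_mem_insert, not_or, and_assoc, Bool.eq_not]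
    rw [heq, Finset.card_insert_of_notMem hl, pow_succ', ← mul_assoc, ← ih']
    congr 1
    convert hhalf

open scoped Classical in
/-- Conditioned on a subformula being satisfied, each further clause is violated with at most
twice its unconditional probability. -/
theorem card_violating_le {V : Type} [DecidableEq V] (F : CNF V) (Ω : Finset (V → Bool))
    (hΩ : ∀ C ∈ F, ∀ x ∈ vbl C, ∀ α ∈ Ω, Function.update α x (!α x) ∈ Ω)
    (hproper : ∀ C ∈ F, ProperClause C)
    (hnb : ∀ C ∈ F, ∑ D ∈ Gamma F C, (2 : ℝ) ^ (-(D.card : ℤ)) ≤ 1 / 4)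
    (S : CNF V) (hS : S ⊆ F) (C : Clause V) (hCF : C ∈ F) (hCS : C ∉ S) :
    ((Ω.filter fun α => ¬ SatClause α C ∧ Satisfies α S).card : ℝ)
      ≤ 2 * 2 ^ (-(C.card : ℤ)) * (Ω.filter fun α => Satisfies α S).card := by
  induction S using Finset.strongInduction generalizing C with
  | H S ih =>
    set T := S.filter fun D => ¬ (vbl D ∩ vbl C).Nonempty
    set N := S.filter fun D => (vbl D ∩ vbl C).Nonempty
    have hTS : T ⊆ S := Finset.filter_subset _ _
    have hindep := card_filter_not_satClause_mul_two_pow Ω C (hproper C hCF) (hΩ C hCF)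
      (fun α => Satisfies α T) (fun x hx α b => by
        refine forall₂_congr fun D hD => exists_congr fun m => and_congr_right fun hm => ?_
        rw [Function.update_of_ne]
        rintro rfl
        exact (Finset.mem_filter.1 hD).2
          ⟨m.1, Finset.mem_inter.2 ⟨Finset.mem_image_of_mem _ hm, hx⟩⟩)
    have hprob : ((Ω.filter fun α => ¬ SatClause α C ∧ Satisfies α T).card : ℝ)
        = 2 ^ (-(C.card : ℤ)) * (Ω.filter fun α => Satisfies α T).card := by
      rw [← hindep, zpow_neg, zpow_natCast]
      push_cast
      field_simp
    have hmono : ((Ω.filter fun α => ¬ SatClause α C ∧ Satisfies α S).card : ℝ)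
        ≤ (Ω.filter fun α => ¬ SatClause α C ∧ Satisfies α T).card := by
      refine Nat.cast_le.2 (Finset.card_le_card fun α hα => ?_)
      simp only [Finset.mem_filter] at hα ⊢
      exact ⟨hα.1, hα.2.1, fun D hD => hα.2.2 D (hTS hD)⟩
    have hunion : ((Ω.filter fun α => Satisfies α T).card : ℝ)
        ≤ (Ω.filter fun α => Satisfies α S).card
          + ∑ D ∈ N, ((Ω.filter fun α => ¬ SatClause α D ∧ Satisfies α T).card : ℝ) := by
      have hcover : (Ω.filter fun α => Satisfies α T) ⊆ (Ω.filter fun α => Satisfies α S)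
          ∪ N.biUnion fun D => Ω.filter fun α => ¬ SatClause α D ∧ Satisfies α T := by
        intro α hα
        obtain ⟨hαΩ, hαT⟩ := Finset.mem_filter.1 hα
        by_cases hαN : ∀ D ∈ N, SatClause α D
        · refine Finset.mem_union_left _ (Finset.mem_filter.2 ⟨hαΩ, fun D hD => ?_⟩)
          by_cases hDC : (vbl D ∩ vbl C).Nonempty
          · exact hαN D (Finset.mem_filter.2 ⟨hD, hDC⟩)
          · exact hαT D (Finset.mem_filter.2 ⟨hD, hDC⟩)
        · push Not at hαN
          obtain ⟨D, hD, hDα⟩ := hαN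
          exact Finset.mem_union_right _ (Finset.mem_biUnion.2
            ⟨D, hD, Finset.mem_filter.2 ⟨hαΩ, hDα, hαT⟩⟩)
      exact_mod_cast (Finset.card_le_card hcover).trans
        ((Finset.card_union_le _ _).trans (Nat.add_le_add_left Finset.card_biUnion_le _))
    have hterm : ∀ D ∈ N, ((Ω.filter fun α => ¬ SatClause α D ∧ Satisfies α T).card : ℝ)
        ≤ 2 * 2 ^ (-(D.card : ℤ)) * (Ω.filter fun α => Satisfies α T).card := by
      intro D hD
      obtain ⟨hDS, hDC⟩ := Finset.mem_filter.1 hD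
      have hDT : D ∉ T := fun h => (Finset.mem_filter.1 h).2 hDC
      exact ih T (Finset.ssubset_iff_subset_ne.2 ⟨hTS, fun h => hDT (h ▸ hDS)⟩)
        (hTS.trans hS) D (hS hDS) hDT
    have hNsum : ∑ D ∈ N, (2 : ℝ) ^ (-(D.card : ℤ)) ≤ 1 / 4 := by
      refine (Finset.sum_le_sum_of_subset_of_nonneg (fun D hD => ?_)
        fun _ _ _ => by positivity).trans (hnb C hCF)
      obtain ⟨hDS, hDC⟩ := Finset.mem_filter.1 hD
      exact Finset.mem_filter.2 ⟨hS hDS, fun h => hCS (h ▸ hDS), hDC⟩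
    have hsum := Finset.sum_le_sum hterm
    rw [← Finset.sum_mul, ← Finset.mul_sum] at hsum
    have hhalf : ((Ω.filter fun α => Satisfies α T).card : ℝ)
        ≤ 2 * (Ω.filter fun α => Satisfies α S).card := by
      have := mul_le_mul_of_nonneg_right hNsum
        (Nat.cast_nonneg (α := ℝ) (Ω.filter fun α => Satisfies α T).card)
      linarith
    calc _ ≤ _ := hmono
      _ = _ := hprob
      _ ≤ 2 ^ (-(C.card : ℤ)) * (2 * ((Ω.filter fun α => Satisfies α S).card : ℝ)) := by gcongr
      _ = _ := by ring

/-- There is a nonempty finite set of assignments closed under flipping any variable of a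
given finite set. -/
theorem exists_finset_assignments_flip_closed {V : Type} [DecidableEq V] (W : Finset V) :
    ∃ Ω : Finset (V → Bool), Ω.Nonempty ∧
      ∀ x ∈ W, ∀ α ∈ Ω, Function.update α x (!α x) ∈ Ω := by
  classical
  refine ⟨W.powerset.image fun A x => decide (x ∈ A),
    (Finset.powerset_nonempty W).image _, fun x hx α hα => ?_⟩
  obtain ⟨A, hA, rfl⟩ := Finset.mem_image.1 hα
  rw [Finset.mem_powerset] at hA
  by_cases hxA : x ∈ A
  · refine Finset.mem_image.2 ⟨A.erase x,
      Finset.mem_powerset.2 ((Finset.erase_subset x A).trans hA), ?_⟩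
    funext y
    by_cases hy : y = x
    · subst hy; simp [hxA]
    · simp [hy]
  · refine Finset.mem_image.2 ⟨insert x A,
      Finset.mem_powerset.2 (Finset.insert_subset hx hA), ?_⟩
    funext y
    by_cases hy : y = x
    · subst hy; simp [hxA]
    · simp [hy]

/-- Let `F` be a CNF formula in which every clause has size at least
`2`. If `Σ_{D ∈ Γ(C)} 2^{-|D|} ≤ 1/4` for every clause `C ∈ F`, then `F` is
satisfiable. -/
theorem local_lemma_satisfiable (V : Type) [DecidableEq V] (F : CNF V)
    (hproper : ∀ C ∈ F, ProperClause C)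
    (hsize : ∀ C ∈ F, 2 ≤ C.card)
    (hnb : ∀ C ∈ F, ∑ D ∈ Gamma F C, (2 : ℝ) ^ (-(D.card : ℤ)) ≤ 1 / 4) :
    ∃ α : V → Bool, Satisfies α F := by
  classical
  obtain ⟨Ω, hne, hflip⟩ := exists_finset_assignments_flip_closed (F.biUnion vbl)
  have hΩ : ∀ C ∈ F, ∀ x ∈ vbl C, ∀ α ∈ Ω, Function.update α x (!α x) ∈ Ω :=
    fun C hC x hx => hflip x (Finset.mem_biUnion.2 ⟨C, hC, hx⟩)
  have hpos : ∀ S ⊆ F, (Ω.filter fun α => Satisfies α S).Nonempty := by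
    intro S
    induction S using Finset.induction_on with
    | empty => exact fun _ => hne.imp fun α hα => Finset.mem_filter.2 ⟨hα, by simp [Satisfies]⟩
    | insert C S hCS ih =>
      intro hS
      obtain ⟨hCF, hSF⟩ := Finset.insert_subset_iff.1 hS
      have hcard : (0 : ℝ) < (Ω.filter fun α => Satisfies α S).card := by
        exact_mod_cast (ih hSF).card_pos
      by_contra hempty
      have hviol : (Ω.filter fun α => ¬ SatClause α C ∧ Satisfies α S)
          = Ω.filter fun α => Satisfies α S := by
        refine Finset.filter_congr fun α hα => and_iff_right_of_imp fun hαS hαC => hempty ?_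
        exact ⟨α, Finset.mem_filter.2 ⟨hα, Finset.forall_mem_insert _ _ _ |>.2 ⟨hαC, hαS⟩⟩⟩
      have hle := card_violating_le F Ω hΩ hproper hnb S hSF C hCF hCS
      have hquarter : (2 : ℝ) ^ (-(C.card : ℤ)) ≤ 2 ^ (-2 : ℤ) :=
        zpow_le_zpow_right₀ one_le_two (by have := hsize C hCF; omega)
      rw [hviol] at hle
      have hle_half : (2 : ℝ) * 2 ^ (-(C.card : ℤ)) ≤ 1 / 2 := by
        norm_num at hquarter ⊢
        linarith
      nlinarith
  obtain ⟨α, hα⟩ := hpos F subset_rfl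
  exact ⟨α, (Finset.mem_filter.1 hα).2⟩
end

section
/- Fix k and let F be a linear [l,k]-CNF formula with l ≥ 1, let C be a clause of F, and let α be a partial assignment defined exactly on the variables of C. If α satisfies C, then F^[α] is a linear [l-1,k]-CNF and d(F^[α]) ≤ d(F) + k. -/
/-- `Γ'(C)`: the neighbors of `C` of size at most `k - 1`. -/
def Gamma' {V : Type} [DecidableEq V] (k : ℕ) (F : CNF V) (C : Clause V) :
    Finset (Clause V) :=
  (Gamma F C).filter fun D => D.card ≤ k - 1

/-- `d_F(x)`: the number of clauses of `F` of size at most `k - 1` containing the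
variable `x`. -/
def degVar {V : Type} [DecidableEq V] (k : ℕ) (F : CNF V) (x : V) : ℕ :=
  (F.filter fun C => x ∈ vbl C ∧ C.card ≤ k - 1).card

/-- `d(F)`: the maximum of `d_F(x)` over all variables `x` of `F`. -/
def degCNF {V : Type} [DecidableEq V] (k : ℕ) (F : CNF V) : ℕ :=
  (F.biUnion vbl).sup (degVar k F)

/-- A partial assignment `α : V → Option Bool` satisfies a clause if some literal of
the clause evaluates to `1` under `α`. -/
def PSatClause {V : Type} (α : V → Option Bool) (C : Clause V) : Prop :=
  ∃ l ∈ C, α l.1 = some l.2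

instance {V : Type} [DecidableEq V] (α : V → Option Bool) (C : Clause V) :
    Decidable (PSatClause α C) := by unfold PSatClause; infer_instance

/-- Applying a partial assignment `α` to `F`: remove every clause satisfied by `α`,
and from the remaining clauses remove all literals evaluating to `0` under `α`.
The result is denoted `F^[α]` in the paper. -/
def applyAssign {V : Type} [DecidableEq V] (α : V → Option Bool) (F : CNF V) : CNF V :=
  (F.filter fun D => ¬ PSatClause α D).image fun D =>
    D.filter fun l => α l.1 ≠ some (!l.2)

theorem mem_vbl {V : Type} [DecidableEq V] {C : Clause V} {x : V} :
    x ∈ vbl C ↔ ∃ b, (x, b) ∈ C := by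
  simp [vbl]

theorem vbl_mono {V : Type} [DecidableEq V] {C D : Clause V} (h : C ⊆ D) : vbl C ⊆ vbl D :=
  Finset.image_subset_image h

theorem card_vbl_le {V : Type} [DecidableEq V] (C : Clause V) : (vbl C).card ≤ C.card :=
  Finset.card_image_le

theorem ProperClause.eq_of_mem {V : Type} {C : Clause V} (h : ProperClause C) {x : V}
    {b c : Bool} (hb : (x, b) ∈ C) (hc : (x, c) ∈ C) : b = c := by
  have := h x
  cases b <;> cases c <;> simp_all

theorem mem_applyAssign {V : Type} [DecidableEq V] {α : V → Option Bool} {F : CNF V}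
    {E : Clause V} :
    E ∈ applyAssign α F ↔ ∃ D ∈ F, ¬ PSatClause α D ∧
      (D.filter fun l => α l.1 ≠ some (!l.2)) = E := by
  simp only [applyAssign, Finset.mem_image, Finset.mem_filter, and_assoc]

theorem linearCNF_applyAssign {V : Type} [DecidableEq V] {F : CNF V} (hF : LinearCNF F)
    (α : V → Option Bool) : LinearCNF (applyAssign α F) := by
  intro E₁ h₁ E₂ h₂ hne
  obtain ⟨D₁, hD₁, -, rfl⟩ := mem_applyAssign.1 h₁
  obtain ⟨D₂, hD₂, -, rfl⟩ := mem_applyAssign.1 h₂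
  have hD : D₁ ≠ D₂ := by
    rintro rfl
    exact hne rfl
  exact (Finset.card_le_card (Finset.inter_subset_inter
    (vbl_mono (Finset.filter_subset _ _)) (vbl_mono (Finset.filter_subset _ _)))).trans
    (hF D₁ hD₁ D₂ hD₂ hD)

/-- A proper clause loses at most as many literals as it has variables in the domain. -/
theorem ProperClause.card_le_card_filter_add {V : Type} [DecidableEq V] {D : Clause V}
    (hD : ProperClause D) {α : V → Option Bool} {S : Finset V}
    (hS : ∀ x, (α x).isSome → x ∈ S) :
    D.card ≤ (D.filter fun l => α l.1 ≠ some (!l.2)).card + (vbl D ∩ S).card := by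
  rw [← Finset.card_filter_add_card_filter_not (s := D) (fun l => α l.1 ≠ some (!l.2))]
  gcongr
  apply Finset.card_le_card_of_injOn Prod.fst
  · rintro ⟨x, b⟩ hx
    simp only [Finset.coe_filter, Set.mem_ofPred_eq, not_not] at hx
    exact Finset.mem_inter.2 ⟨mem_vbl.2 ⟨b, hx.1⟩, hS x (by simp [hx.2])⟩
  · rintro ⟨x, b⟩ hx ⟨y, c⟩ hy (rfl : x = y)
    simp only [Finset.coe_filter, Set.mem_ofPred_eq] at hx hy
    rw [hD.eq_of_mem hx.1 hy.1]

/-- In a linear formula, for `x ∉ S`, at most `S.card` clauses contain `x` and meet `S`. -/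
theorem LinearCNF.card_filter_mem_vbl_inter_nonempty_le {V : Type} [DecidableEq V] {F : CNF V}
    (hF : LinearCNF F) {S : Finset V} {x : V} (hx : x ∉ S) :
    (F.filter fun D => x ∈ vbl D ∧ (vbl D ∩ S).Nonempty).card ≤ S.card := by
  refine Finset.card_le_card_of_forall_subsingleton (fun D y => y ∈ vbl D) ?_ ?_
  · intro D hD
    obtain ⟨y, hy⟩ := (Finset.mem_filter.1 hD).2.2
    exact ⟨y, (Finset.mem_inter.1 hy).2, (Finset.mem_inter.1 hy).1⟩
  · rintro y hy D₁ ⟨h₁, hy₁⟩ D₂ ⟨h₂, hy₂⟩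
    by_contra hne
    rw [Finset.mem_filter] at h₁ h₂
    have hle := hF D₁ h₁.1 D₂ h₂.1 hne
    have hxy : x = y := Finset.card_le_one.1 hle x (Finset.mem_inter.2 ⟨h₁.2.1, h₂.2.1⟩)
      y (Finset.mem_inter.2 ⟨hy₁, hy₂⟩)
    exact hx (hxy ▸ hy)

theorem apply_eq_none_of_mem_vbl_filter {V : Type} [DecidableEq V] {α : V → Option Bool}
    {D : Clause V} (hD : ¬ PSatClause α D) {x : V}
    (hx : x ∈ vbl (D.filter fun l => α l.1 ≠ some (!l.2))) : α x = none := by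
  obtain ⟨b, hb⟩ := mem_vbl.1 hx
  rw [Finset.mem_filter] at hb
  have hne : α x ≠ some b := fun h => hD ⟨(x, b), hb.1, h⟩
  have hb' : α x ≠ some (!b) := hb.2
  rcases h : α x with _ | c
  · rfl
  · cases b <;> cases c <;> simp_all

theorem degVar_le_degCNF {V : Type} [DecidableEq V] (k : ℕ) (F : CNF V) (x : V) :
    degVar k F x ≤ degCNF k F := by
  by_cases hx : x ∈ F.biUnion vbl
  · exact Finset.le_sup hx
  · have : degVar k F x = 0 := by
      refine Finset.card_eq_zero.2 (Finset.filter_eq_empty_iff.2 fun D hD h => hx ?_)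
      exact Finset.mem_biUnion.2 ⟨D, hD, h.1⟩
    omega

theorem LinearCNF.degVar_applyAssign_le {V : Type} [DecidableEq V] {F : CNF V}
    (hlin : LinearCNF F) (hF : ∀ D ∈ F, ProperClause D) (k : ℕ) {α : V → Option Bool}
    {S : Finset V} (hS : ∀ x, (α x).isSome → x ∈ S) {x : V} (hx : x ∉ S) :
    degVar k (applyAssign α F) x ≤ degVar k F x + S.card := by
  refine le_trans ?_ (Nat.add_le_add_left (hlin.card_filter_mem_vbl_inter_nonempty_le hx) _)
  refine le_trans ?_ (Finset.card_union_le _ _)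
  refine le_trans (Finset.card_le_card ?_)
    (Finset.card_image_le (f := fun D => D.filter fun l => α l.1 ≠ some (!l.2)))
  intro E hE
  obtain ⟨hE, hxE, hcard⟩ := Finset.mem_filter.1 hE
  obtain ⟨D, hD, -, rfl⟩ := mem_applyAssign.1 hE
  have hxD : x ∈ vbl D := vbl_mono (Finset.filter_subset _ _) hxE
  refine Finset.mem_image.2 ⟨D, ?_, rfl⟩
  rw [Finset.mem_union, Finset.mem_filter, Finset.mem_filter]
  by_cases hk : D.card ≤ k - 1
  · exact Or.inl ⟨hD, hxD, hk⟩
  · refine Or.inr ⟨hD, hxD, Finset.card_pos.1 ?_⟩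
    have := (hF D hD).card_le_card_filter_add hS
    omega

/-- Fix `k`, let `F` be a linear `[l,k]`-CNF with `l ≥ 1`, let `C` be
a clause of `F`, and let `α` be a partial assignment defined exactly on the variables
of `C`. If `α` satisfies `C`, then `F^[α]` is a linear `[l-1,k]`-CNF and
`d(F^[α]) ≤ d(F) + k`. -/
theorem apply_assignment_properties (k l : ℕ) (hl : 1 ≤ l)
    (V : Type) [DecidableEq V] (F : CNF V)
    (hproper : ∀ C ∈ F, ProperClause C)
    (hlin : LinearCNF F)
    (hlk : ∀ C ∈ F, l ≤ C.card ∧ C.card ≤ k)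
    (C : Clause V) (hC : C ∈ F)
    (α : V → Option Bool)
    (hdom : ∀ x : V, (α x).isSome ↔ x ∈ vbl C)
    (hsatC : PSatClause α C) :
    LinearCNF (applyAssign α F) ∧
    (∀ D ∈ applyAssign α F, l - 1 ≤ D.card ∧ D.card ≤ k) ∧
    degCNF k (applyAssign α F) ≤ degCNF k F + k := by
  have hS : ∀ x, (α x).isSome → x ∈ vbl C := fun x => (hdom x).1
  refine ⟨linearCNF_applyAssign hlin α, fun E hE => ?_, Finset.sup_le fun x hx => ?_⟩
  · obtain ⟨D, hD, hsat, rfl⟩ := mem_applyAssign.1 hE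
    have hDC : D ≠ C := by
      rintro rfl
      exact hsat hsatC
    have hcard := (hproper D hD).card_le_card_filter_add hS
    have hinter := hlin D hD C hC hDC
    have hle := (hlk D hD).1
    exact ⟨by omega, (Finset.card_filter_le _ _).trans (hlk D hD).2⟩
  · obtain ⟨E, hE, hxE⟩ := Finset.mem_biUnion.1 hx
    obtain ⟨D, hD, hsat, rfl⟩ := mem_applyAssign.1 hE
    have hxC : x ∉ vbl C := by
      rw [← hdom, apply_eq_none_of_mem_vbl_filter hsat hxE]
      simp
    exact (hlin.degVar_applyAssign_le hproper k hS hxC).trans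
      (Nat.add_le_add (degVar_le_degCNF k F x) ((card_vbl_le C).trans (hlk C hC).2))
end

section
/- Let u, v, w be literals over three distinct variables, and let x₁, x₂, x₃, x₄ be four further distinct variables disjoint from the variables of u, v, w. Define F₆({u,v,w}) := { {x̄₁,x₂,u}, {x̄₂,x₃,v}, {x̄₃,x₄,u}, {x̄₄,x₁,v}, {x₁,x₃,w}, {x̄₂,x̄₄,w} }. Then F₆({u,v,w}) is a linear 3-CNF formula with 6 clauses, it is satisfiable, and every assignment that satisfies F₆({u,v,w}) satisfies the clause {u,v,w} (i.e., F₆({u,v,w}) is a {u,v,w}-forcer). -/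
/-- The formula `F₆({u,v,w})` from the paper: here a variable `x` as a positive
literal is `(x, true)` and its negation `x̄` is `(x, false)`. -/
def F6 {V : Type} [DecidableEq V] (u v w : V × Bool) (x1 x2 x3 x4 : V) : CNF V :=
  { {(x1, false), (x2, true), u}, {(x2, false), (x3, true), v},
    {(x3, false), (x4, true), u}, {(x4, false), (x1, true), v},
    {(x1, true), (x3, true), w}, {(x2, false), (x4, false), w} }

lemma vbl_triple {V : Type} [DecidableEq V] (a b c : V × Bool) :
    vbl ({a, b, c} : Clause V) = {a.1, b.1, c.1} := by
  simp [vbl, Finset.image_insert]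

lemma properClause_triple {V : Type} [DecidableEq V] {a b c : V × Bool}
    (hab : a.1 ≠ b.1) (hac : a.1 ≠ c.1) (hbc : b.1 ≠ c.1) :
    ProperClause ({a, b, c} : Clause V) := by
  intro x
  simp only [Finset.mem_insert, Finset.mem_singleton]
  grind

lemma card_triple_of_fst_ne {V : Type} [DecidableEq V] {a b c : V × Bool}
    (hab : a.1 ≠ b.1) (hac : a.1 ≠ c.1) (hbc : b.1 ≠ c.1) :
    ({a, b, c} : Clause V).card = 3 :=
  Finset.card_eq_three.2 ⟨a, b, c, ne_of_apply_ne _ hab, ne_of_apply_ne _ hac,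
    ne_of_apply_ne _ hbc, rfl⟩

lemma card_vbl_of_properClause {V : Type} [DecidableEq V] {C : Clause V} (h : ProperClause C) :
    (vbl C).card = C.card := by
  refine Finset.card_image_of_injOn ?_
  rintro ⟨x, b⟩ hb ⟨y, c⟩ hc rfl
  have := h x
  cases b <;> cases c <;> simp_all

lemma linearCNF_toFinset {V : Type} [DecidableEq V] {L : List (Clause V)}
    (h : L.Pairwise fun C D => (vbl C ∩ vbl D).card ≤ 1) : LinearCNF L.toFinset := by
  have : Std.Symm fun C D : Clause V => (vbl C ∩ vbl D).card ≤ 1 :=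
    ⟨fun C D hCD => by rwa [Finset.inter_comm]⟩
  intro C hC D hD hne
  exact h.forall (List.mem_toFinset.1 hC) (List.mem_toFinset.1 hD) hne

lemma card_toFinset_of_isKCNF {V : Type} [DecidableEq V] {k : ℕ} (hk : 2 ≤ k)
    {L : List (Clause V)} (hL : IsKCNF k L.toFinset)
    (h : L.Pairwise fun C D => (vbl C ∩ vbl D).card ≤ 1) : L.toFinset.card = L.length := by
  refine List.toFinset_card_of_nodup (h.imp_of_mem fun {C D} hC _ hCD hne => ?_)
  obtain ⟨hp, hc⟩ := hL C (List.mem_toFinset.2 hC)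
  rw [← hne, Finset.inter_self, card_vbl_of_properClause hp, hc] at hCD
  omega

/-- Let `u, v, w` be literals over three distinct variables and
`x₁, x₂, x₃, x₄` four further distinct variables disjoint from the variables of
`u, v, w`. Then `F₆({u,v,w})` is a linear 3-CNF with 6 clauses, it is satisfiable, and
every assignment satisfying it satisfies the clause `{u,v,w}` (it is a
`{u,v,w}`-forcer). -/
theorem F6_is_forcer (V : Type) [DecidableEq V] (u v w : V × Bool) (x1 x2 x3 x4 : V)
    (hdist : [u.1, v.1, w.1, x1, x2, x3, x4].Pairwise (· ≠ ·)) :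
    IsKCNF 3 (F6 u v w x1 x2 x3 x4) ∧
    LinearCNF (F6 u v w x1 x2 x3 x4) ∧
    (F6 u v w x1 x2 x3 x4).card = 6 ∧
    (∃ α : V → Bool, Satisfies α (F6 u v w x1 x2 x3 x4)) ∧
    (∀ α : V → Bool, Satisfies α (F6 u v w x1 x2 x3 x4) →
      SatClause α {u, v, w}) := by
  obtain ⟨u, bu⟩ := u
  obtain ⟨v, bv⟩ := v
  obtain ⟨w, bw⟩ := w
  simp only [List.pairwise_cons, List.mem_cons, List.not_mem_nil, or_false, forall_eq_or_imp,
    forall_eq] at hdist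
  have hF : F6 (u, bu) (v, bv) (w, bw) x1 x2 x3 x4 = List.toFinset
      [{(x1, false), (x2, true), (u, bu)}, {(x2, false), (x3, true), (v, bv)},
        {(x3, false), (x4, true), (u, bu)}, {(x4, false), (x1, true), (v, bv)},
        {(x1, true), (x3, true), (w, bw)}, {(x2, false), (x4, false), (w, bw)}] := by
    simp [F6]
  have hK : IsKCNF 3 (F6 (u, bu) (v, bv) (w, bw) x1 x2 x3 x4) := by
    intro C hC
    simp only [F6, Finset.mem_insert, Finset.mem_singleton] at hC
    rcases hC with rfl | rfl | rfl | rfl | rfl | rfl <;>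
      exact ⟨properClause_triple (by grind) (by grind) (by grind),
        card_triple_of_fst_ne (by grind) (by grind) (by grind)⟩
  have hP : List.Pairwise (fun C D : Clause V => (vbl C ∩ vbl D).card ≤ 1)
      [{(x1, false), (x2, true), (u, bu)}, {(x2, false), (x3, true), (v, bv)},
        {(x3, false), (x4, true), (u, bu)}, {(x4, false), (x1, true), (v, bv)},
        {(x1, true), (x3, true), (w, bw)}, {(x2, false), (x4, false), (w, bw)}] := by
    simp only [List.pairwise_cons, List.mem_cons, List.not_mem_nil, or_false, forall_eq_or_imp,
      forall_eq, vbl_triple, Finset.card_le_one, Finset.mem_inter, Finset.mem_insert,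
      Finset.mem_singleton, List.Pairwise.nil, IsEmpty.forall_iff, implies_true, and_true]
    clear hF hK
    and_intros <;> grind
  refine ⟨hK, hF ▸ linearCNF_toFinset hP, ?_, ?_, ?_⟩
  · rw [hF] at hK ⊢
    exact card_toFinset_of_isKCNF (by norm_num) hK hP
  · refine ⟨fun x => if x = u then bu else if x = v then bv else bw, ?_⟩
    simp only [Satisfies, SatClause, F6, Finset.mem_insert, Finset.mem_singleton,
      forall_eq_or_imp, forall_eq, exists_eq_or_imp, exists_eq_left]
    grind
  · intro α hα
    simp only [Satisfies, SatClause, F6, Finset.mem_insert, Finset.mem_singleton,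
      forall_eq_or_imp, forall_eq, exists_eq_or_imp, exists_eq_left] at hα ⊢
    grind
end

section
/- Let u, v be literals over two distinct variables, and let x₁, …, x₆ be six further distinct variables disjoint from the variables of u, v. Define F₈({u,v}) := { {x̄₁,x₂,u}, {x̄₂,x₃,v}, {x̄₃,x₄,u}, {x̄₄,x₅,v}, {x̄₅,x₆,u}, {x̄₆,x₁,v}, {x₁,x₃,x₅}, {x̄₂,x̄₄,x̄₆} }. Then F₈({u,v}) is a linear 3-CNF formula with 8 clauses, it is satisfiable, and every assignment that satisfies F₈({u,v}) satisfies the clause {u,v} (i.e., F₈({u,v}) is a {u,v}-forcer). -/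
/-- The formula `F₈({u,v})` from the paper: here a variable `x` as a positive literal
is `(x, true)` and its negation `x̄` is `(x, false)`. -/
def F8 {V : Type} [DecidableEq V] (u v : V × Bool) (x1 x2 x3 x4 x5 x6 : V) : CNF V :=
  { {(x1, false), (x2, true), u}, {(x2, false), (x3, true), v},
    {(x3, false), (x4, true), u}, {(x4, false), (x5, true), v},
    {(x5, false), (x6, true), u}, {(x6, false), (x1, true), v},
    {(x1, true), (x3, true), (x5, true)}, {(x2, false), (x4, false), (x6, false)} }

/-- Rename the variables of a clause along an injection. -/
def renameClause {V W : Type} (f : V ↪ W) : Clause V ↪ Clause W :=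
  Finset.mapEmbedding (f.prodMap (Function.Embedding.refl Bool)) |>.toEmbedding

lemma mem_renameClause {V W : Type} (f : V ↪ W) (C : Clause V) (x : V) (b : Bool) :
    (f x, b) ∈ renameClause f C ↔ (x, b) ∈ C := by
  simp [renameClause]

lemma vbl_renameClause {V W : Type} [DecidableEq V] [DecidableEq W] (f : V ↪ W)
    (C : Clause V) : vbl (renameClause f C) = (vbl C).map f := by
  ext w
  simp only [vbl, renameClause, Finset.mem_image, Finset.mem_map, RelEmbedding.coe_toEmbedding,
    Finset.mapEmbedding_apply]
  aesop

lemma IsKCNF.rename {V W : Type} (f : V ↪ W) {k : ℕ} {F : CNF V} (h : IsKCNF k F) :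
    IsKCNF k (F.map (renameClause f)) := by
  intro C' hC'
  obtain ⟨C, hC, rfl⟩ := Finset.mem_map.1 hC'
  refine ⟨?_, by simpa [renameClause] using (h C hC).2⟩
  rintro y ⟨ht, hf⟩
  obtain ⟨⟨x, b⟩, -, hx⟩ := Finset.mem_map.1 ht
  obtain rfl : f x = y := congrArg Prod.fst hx
  exact (h C hC).1 x
    ⟨(mem_renameClause f C x true).1 ht, (mem_renameClause f C x false).1 hf⟩

lemma LinearCNF.rename {V W : Type} [DecidableEq V] [DecidableEq W] (f : V ↪ W)
    {F : CNF V} (h : LinearCNF F) : LinearCNF (F.map (renameClause f)) := by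
  intro C' hC' D' hD' hne
  obtain ⟨C, hC, rfl⟩ := Finset.mem_map.1 hC'
  obtain ⟨D, hD, rfl⟩ := Finset.mem_map.1 hD'
  rw [vbl_renameClause, vbl_renameClause, ← Finset.map_inter, Finset.card_map]
  exact h C hC D hD fun e => hne (e ▸ rfl)

lemma satClause_renameClause {V W : Type} (f : V ↪ W) (α : W → Bool) (C : Clause V) :
    SatClause α (renameClause f C) ↔ SatClause (α ∘ f) C := by
  simp only [SatClause, renameClause, RelEmbedding.coe_toEmbedding, Finset.mapEmbedding_apply,
    Finset.mem_map, exists_exists_and_eq_and]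
  rfl

lemma satisfies_rename {V W : Type} (f : V ↪ W) (α : W → Bool) (F : CNF V) :
    Satisfies α (F.map (renameClause f)) ↔ Satisfies (α ∘ f) F := by
  simp [Satisfies, satClause_renameClause]

lemma F8_rename {V W : Type} [DecidableEq V] [DecidableEq W] (f : V ↪ W) (u v : V × Bool)
    (x1 x2 x3 x4 x5 x6 : V) :
    F8 (f u.1, u.2) (f v.1, v.2) (f x1) (f x2) (f x3) (f x4) (f x5) (f x6) =
      (F8 u v x1 x2 x3 x4 x5 x6).map (renameClause f) := by
  simp [F8, renameClause, Prod.map]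

instance {V : Type} [DecidableEq V] [Fintype V] (C : Clause V) : Decidable (ProperClause C) := by
  unfold ProperClause; infer_instance

instance {V : Type} [DecidableEq V] [Fintype V] (k : ℕ) (F : CNF V) : Decidable (IsKCNF k F) :=
  Finset.decidableDforallFinset

instance {V : Type} [DecidableEq V] (F : CNF V) : Decidable (LinearCNF F) :=
  have (C : Clause V) : Decidable (∀ D ∈ F, C ≠ D → (vbl C ∩ vbl D).card ≤ 1) :=
    Finset.decidableDforallFinset
  Finset.decidableDforallFinset

instance {V : Type} [DecidableEq V] (α : V → Bool) (F : CNF V) : Decidable (Satisfies α F) :=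
  Finset.decidableDforallFinset

lemma isKCNF_F8_fin (a b : Bool) :
    IsKCNF 3 (F8 ((0 : Fin 8), a) (1, b) 2 3 4 5 6 7) := by
  revert a b
  decide +kernel

lemma linearCNF_F8_fin (a b : Bool) :
    LinearCNF (F8 ((0 : Fin 8), a) (1, b) 2 3 4 5 6 7) := by
  revert a b
  decide +kernel

lemma card_F8_fin (a b : Bool) :
    (F8 ((0 : Fin 8), a) (1, b) 2 3 4 5 6 7).card = 8 := by
  revert a b
  decide +kernel

lemma satisfies_F8_fin (a b : Bool) :
    Satisfies ![a, b, true, true, true, false, false, false]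
      (F8 ((0 : Fin 8), a) (1, b) 2 3 4 5 6 7) := by
  revert a b
  decide +kernel

lemma satClause_of_satisfies_F8 {V : Type} [DecidableEq V] {u v : V × Bool}
    {x1 x2 x3 x4 x5 x6 : V} {α : V → Bool} (h : Satisfies α (F8 u v x1 x2 x3 x4 x5 x6)) :
    SatClause α {u, v} := by
  simp only [Satisfies, F8, SatClause, Finset.mem_insert, Finset.mem_singleton,
    forall_eq_or_imp, forall_eq, exists_eq_or_imp, exists_eq_left] at h ⊢
  grind

/-- Let `u, v` be literals over two distinct variables and
`x₁, …, x₆` six further distinct variables disjoint from the variables of `u, v`.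
Then `F₈({u,v})` is a linear 3-CNF with 8 clauses, it is satisfiable, and every
assignment satisfying it satisfies the clause `{u,v}` (it is a `{u,v}`-forcer). -/
theorem F8_is_forcer (V : Type) [DecidableEq V] (u v : V × Bool)
    (x1 x2 x3 x4 x5 x6 : V)
    (hdist : [u.1, v.1, x1, x2, x3, x4, x5, x6].Pairwise (· ≠ ·)) :
    IsKCNF 3 (F8 u v x1 x2 x3 x4 x5 x6) ∧
    LinearCNF (F8 u v x1 x2 x3 x4 x5 x6) ∧
    (F8 u v x1 x2 x3 x4 x5 x6).card = 8 ∧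
    (∃ α : V → Bool, Satisfies α (F8 u v x1 x2 x3 x4 x5 x6)) ∧
    (∀ α : V → Bool, Satisfies α (F8 u v x1 x2 x3 x4 x5 x6) →
      SatClause α {u, v}) := by
  have hinj : Function.Injective ![u.1, v.1, x1, x2, x3, x4, x5, x6] := by
    have h : [u.1, v.1, x1, x2, x3, x4, x5, x6].Nodup := hdist
    exact List.nodup_ofFn.1 (by simpa [List.ofFn_succ] using h)
  let f : Fin 8 ↪ V := ⟨_, hinj⟩
  have hF : F8 u v x1 x2 x3 x4 x5 x6 =
      (F8 ((0 : Fin 8), u.2) (1, v.2) 2 3 4 5 6 7).map (renameClause f) :=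
    F8_rename f (0, u.2) (1, v.2) 2 3 4 5 6 7
  refine ⟨?_, ?_, ?_, ?_, fun α => satClause_of_satisfies_F8⟩
  · exact hF ▸ (isKCNF_F8_fin u.2 v.2).rename f
  · exact hF ▸ (linearCNF_F8_fin u.2 v.2).rename f
  · rw [hF, Finset.card_map, card_F8_fin]
  · obtain ⟨α, hα⟩ := f.injective.surjective_comp_right (γ := Bool)
      ![u.2, v.2, true, true, true, false, false, false]
    refine ⟨α, ?_⟩
    rw [hF, satisfies_rename, show α ∘ f = _ from hα]
    exact satisfies_F8_fin u.2 v.2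
end
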